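/- Let V be a finite-dimensional K-vector space. The order-preserving map f from the poset of simplices of 𝓛(V) (simplices of lines of V whose vertices span a proper subspace) to the poset 𝒯(V) of proper nonzero subspaces of V, sending a simplex to the span of its vertices, has the property that for every proper nonzero subspace W ⊆ V, the downward fiber f_{≤W} = {σ | span(σ) ⊆ W} is the face poset of a cone, hence contractible. -/

import Mathlib

open CategoryTheory Module
section
open Opposite Simplicial

noncomputable section
namespace DFC
variable {P : Type} [PartialOrder P]

def mk {n : ℕ} (a : Fin (n+1) →o P) : (nerve P).obj (op ⦋n⦌) := a.monotone.functor

def pt {n : ℕ} (a : Fin (n+1) →o P) : C(stdSimplex ℝ (Fin (n+1)), SSet.toTop.obj (nerve P)) :=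
  TopCat.toSSetObjEquiv _ _ ((sSetTopAdj.unit.app (nerve P)).app (op ⦋n⦌) (mk a))

lemma mk_comp {m n : ℕ} (a : Fin (n+1) →o P) (θ : Fin (m+1) →o Fin (n+1)) :
    mk (a.comp θ) = (nerve P).map (SimplexCategory.mkHom θ).op (mk a) := rfl

lemma pt_comp {m n : ℕ} (a : Fin (n+1) →o P) (θ : Fin (m+1) →o Fin (n+1))
    (w : stdSimplex ℝ (Fin (m+1))) :
    pt (a.comp θ) w = pt a (stdSimplex.map θ w) := by
  unfold pt
  have := congrArg (fun k => k.hom (mk a)) ((sSetTopAdj.unit.app (nerve P)).naturality (SimplexCategory.mkHom θ).op)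
  exact congrArg (fun x => TopCat.toSSetObjEquiv _ _ x w) this

open Classical in
def meas {n : ℕ} (a : Fin (n+1) → P) (w : Fin (n+1) → ℝ) : P → ℝ :=
  fun y => ∑ i, if a i = y then w i else 0

open Classical in
def push {m n : ℕ} (θ : Fin (m+1) → Fin (n+1)) (w : Fin (m+1) → ℝ) : Fin (n+1) → ℝ :=
  fun j => ∑ i, if θ i = j then w i else 0

lemma meas_comp {m n : ℕ} (a : Fin (n+1) → P) (θ : Fin (m+1) → Fin (n+1)) (w : Fin (m+1) → ℝ) :
    meas (a ∘ θ) w = meas a (push θ w) := by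
  classical
  ext y
  simp only [meas, push, Function.comp]
  have : ∀ j, (if a j = y then ∑ i, (if θ i = j then w i else 0) else 0)
      = ∑ i, if θ i = j then (if a (θ i) = y then w i else 0) else 0 := by
    intro j
    by_cases h : a j = y
    · rw [if_pos h]
      refine Finset.sum_congr rfl fun i _ => ?_
      by_cases h' : θ i = j
      · simp [h', h]
      · simp [h']
    · rw [if_neg h]
      refine (Finset.sum_eq_zero fun i _ => ?_).symm
      by_cases h' : θ i = j
      · simp [h', h]
      · simp [h']
  simp_rw [this]
  rw [Finset.sum_comm]
  simp

lemma map_eq_push {m n : ℕ} (θ : Fin (m+1) → Fin (n+1)) (w : stdSimplex ℝ (Fin (m+1))) :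
    ⇑(stdSimplex.map θ w) = push θ w := by
  classical
  ext j
  simp [stdSimplex.map_coe, push, FunOnFinite.linearMap_apply_apply, Finset.sum_filter]

lemma normal {n : ℕ} : ∀ (a : Fin (n+1) →o P) (w : stdSimplex ℝ (Fin (n+1))),
    ∃ (m : ℕ) (e : Fin (m+1) →o P) (v : stdSimplex ℝ (Fin (m+1))),
      Function.Injective e ∧ (∀ j, v j ≠ 0) ∧ pt a w = pt e v ∧ meas a w = meas e v := by
  classical
  induction n with
  | zero =>
    intro a w
    refine ⟨0, a, w, fun x y _ => by omega, ?_, rfl, rfl⟩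
    intro j
    have := stdSimplex.sum_eq_one w
    have hj : j = 0 := by omega
    subst hj
    simp at this
    simp
  | succ n ih =>
    intro a w
    by_cases hw : ∀ j, w j ≠ 0
    · by_cases ha : ∀ i : Fin (n+1), a i.castSucc < a i.succ
      · exact ⟨n+1, a, w, (Fin.strictMono_iff_lt_succ.2 ha).injective, hw, rfl, rfl⟩
      · push Not at ha
        obtain ⟨i, hi⟩ := ha
        have hi : a i.castSucc = a i.succ :=
          eq_of_le_of_not_lt (a.monotone (Fin.castSucc_le_succ i)) hi
        let d : Fin (n+1) →o Fin (n+2) := ⟨i.castSucc.succAbove, (Fin.strictMono_succAbove _).monotone⟩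
        let s : Fin (n+2) →o Fin (n+1) := ⟨i.predAbove, Fin.predAbove_right_monotone _⟩
        have e : a = (a.comp d).comp s := by
          ext j
          simp only [OrderHom.comp_coe, Function.comp, d, s, OrderHom.coe_mk]
          by_cases hj : j = i.castSucc
          · subst hj
            simp [hi]
          · rw [Fin.succAbove_predAbove hj]
        obtain ⟨m, e', v, h1, h2, h3, h4⟩ := ih (a.comp d) (stdSimplex.map s w)
        refine ⟨m, e', v, h1, h2, ?_, ?_⟩
        · rw [← h3, ← pt_comp, ← e]
        · rw [← h4, map_eq_push, ← meas_comp]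
          exact congrArg (fun b : Fin (n+2) →o P => meas b w) e
    · push Not at hw
      obtain ⟨i, hi⟩ := hw
      let d : Fin (n+1) →o Fin (n+2) := ⟨i.succAbove, (Fin.strictMono_succAbove _).monotone⟩
      let w' : stdSimplex ℝ (Fin (n+1)) := ⟨fun j => w (i.succAbove j), fun j => w.2.1 _, by
        have := stdSimplex.sum_eq_one w
        rw [Fin.sum_univ_succAbove _ i, hi, zero_add] at this
        exact this⟩
      have hw' : stdSimplex.map d w' = w := by
        apply stdSimplex.ext
        change ⇑(stdSimplex.map d w') = ⇑w
        rw [map_eq_push]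
        ext j
        change (∑ k, if i.succAbove k = j then w (i.succAbove k) else 0) = w j
        by_cases hj : j = i
        · subst hj
          rw [hi]
          simp
        · obtain ⟨k, rfl⟩ := Fin.exists_succAbove_eq hj
          simp
      obtain ⟨m, e', v, h1, h2, h3, h4⟩ := ih (a.comp d) w'
      refine ⟨m, e', v, h1, h2, ?_, ?_⟩
      · rw [← h3, pt_comp, hw']
      · rw [← h4]
        conv_lhs => rw [← hw', map_eq_push, ← meas_comp]
        rfl

lemma meas_inj_apply {n : ℕ} (e : Fin (n+1) → P) (he : Function.Injective e) (v : Fin (n+1) → ℝ)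
    (j) : meas e v (e j) = v j := by
  simp [meas, he.eq_iff]

lemma range_eq {n : ℕ} (e : Fin (n+1) → P) (he : Function.Injective e) (v : Fin (n+1) → ℝ)
    (hv : ∀ j, v j ≠ 0) : Set.range e = {y | meas e v y ≠ 0} := by
  ext y
  constructor
  · rintro ⟨j, rfl⟩
    simp [meas_inj_apply e he, hv]
  · intro h
    by_contra h'
    apply h
    refine Finset.sum_eq_zero fun i _ => if_neg fun h2 => h' ⟨i, h2⟩

lemma pt_eq_of_meas {n m : ℕ} (a : Fin (n+1) →o P) (w : stdSimplex ℝ (Fin (n+1)))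
    (a' : Fin (m+1) →o P) (w' : stdSimplex ℝ (Fin (m+1))) (h : meas a w = meas a' w') :
    pt a w = pt a' w' := by
  obtain ⟨k, e, v, h1, h2, h3, h4⟩ := normal a w
  obtain ⟨k', e', v', h1', h2', h3', h4'⟩ := normal a' w'
  rw [h3, h3']
  have hm : meas e v = meas e' v' := by rw [← h4, ← h4', h]
  have hr : Set.range e = Set.range e' := by
    rw [range_eq e h1 v h2, range_eq e' h1' v' h2', hm]
  have hk : k = k' := by
    have := congrArg Set.ncard hr
    rw [← Set.image_univ, ← Set.image_univ, Set.ncard_image_of_injective _ h1,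
      Set.ncard_image_of_injective _ h1'] at this
    simpa using this
  subst hk
  have he : (e : Fin (k+1) → P) = e' := (StrictMono.range_inj
    (e.monotone.strictMono_of_injective h1) (e'.monotone.strictMono_of_injective h1')).1 hr
  have he : e = e' := OrderHom.ext _ _ he
  subst he
  congr 1
  apply stdSimplex.ext
  ext j
  have := congrFun hm (e j)
  rwa [meas_inj_apply e h1, meas_inj_apply e h1] at this

open Classical in
def PT (Q : Type) [PartialOrder Q] [Nonempty Q] (μ : Q → ℝ) : SSet.toTop.obj (nerve Q) :=
  if h : ∃ (n : ℕ) (a : Fin (n+1) →o Q) (w : stdSimplex ℝ (Fin (n+1))), meas a w = μ then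
    pt h.choose_spec.choose h.choose_spec.choose_spec.choose
  else pt (OrderHom.const (Fin 1) (Classical.arbitrary Q)) default

lemma PT_eq [Nonempty P] {n : ℕ} (a : Fin (n+1) →o P) (w : stdSimplex ℝ (Fin (n+1)))
    (μ : P → ℝ) (h : meas a w = μ) : PT P μ = pt a w := by
  have h' : ∃ (n : ℕ) (a : Fin (n+1) →o P) (w : stdSimplex ℝ (Fin (n+1))), meas a w = μ :=
    ⟨n, a, w, h⟩
  rw [PT, dif_pos h']
  exact pt_eq_of_meas _ _ _ _ (h'.choose_spec.choose_spec.choose_spec.trans h.symm)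


def low {n : ℕ} (p : Fin (n+1) → ℝ) (u : ℝ) (i : Fin (n+1)) : ℝ :=
  min (∑ j ∈ Finset.Iic i, p j) u - min (∑ j ∈ Finset.Iio i, p j) u

lemma sum_Iic_eq {n : ℕ} (p : Fin (n+1) → ℝ) (i : Fin (n+1)) :
    ∑ j ∈ Finset.Iic i, p j = ∑ j ∈ Finset.Iio i, p j + p i := by
  have : Finset.Iic i = insert i (Finset.Iio i) := by
    ext x; simp [le_iff_lt_or_eq, or_comm]
  rw [this, Finset.sum_insert (by simp), add_comm]

lemma sum_low {n : ℕ} (p : Fin (n+1) → ℝ) (u : ℝ) (hu : 0 ≤ u) (S : Finset (Fin (n+1))) :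
    (∀ x ∈ S, ∀ y, y ≤ x → y ∈ S) → ∑ i ∈ S, low p u i = min (∑ i ∈ S, p i) u := by
  induction S using Finset.induction_on_max with
  | empty => simp [hu]
  | insert a s hs ih =>
    intro hS
    have ha : a ∉ s := fun h => lt_irrefl _ (hs a h)
    have hs' : s = Finset.Iio a := by
      ext x
      simp only [Finset.mem_Iio]
      refine ⟨hs x, fun hx => ?_⟩
      have := hS a (by simp) x hx.le
      rcases Finset.mem_insert.1 this with h | h
      · exact absurd h hx.ne
      · exact h
    rw [Finset.sum_insert ha, Finset.sum_insert ha, ih, low, sum_Iic_eq, ← hs']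
    · rw [add_comm (p a)]; ring
    · intro x hx y hy
      rw [hs', Finset.mem_Iio] at *
      exact hy.trans_lt hx

lemma sum_push {m n : ℕ} (θ : Fin (m+1) → Fin (n+1)) (w : Fin (m+1) → ℝ) (S : Finset (Fin (n+1))) :
    ∑ j ∈ S, push θ w j = ∑ i with θ i ∈ S, w i := by
  classical
  simp only [push]
  rw [Finset.sum_comm, Finset.sum_filter]
  simp

lemma low_push {m n : ℕ} (θ : Fin (m+1) →o Fin (n+1)) (p : Fin (m+1) → ℝ) (u : ℝ) (hu : 0 ≤ u) :
    low (push θ p) u = push θ (low p u) := by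
  classical
  ext j
  have h1 := sum_Iic_eq (push θ (low p u)) j
  have h2 : push θ (low p u) j = ∑ j ∈ Finset.Iic j, push θ (low p u) j
      - ∑ j ∈ Finset.Iio j, push θ (low p u) j := by linarith
  rw [h2, low]
  simp only [sum_push]
  rw [sum_low p u hu, sum_low p u hu]
  · intro x hx y hy
    simp only [Finset.mem_filter, Finset.mem_univ, true_and, Finset.mem_Iio] at *
    exact (θ.monotone hy).trans_lt hx
  · intro x hx y hy
    simp only [Finset.mem_filter, Finset.mem_univ, true_and, Finset.mem_Iic] at *
    exact (θ.monotone hy).trans hx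

lemma sum_prism {n : ℕ} (k : Fin (n+1)) (F G : Fin (n+1) → ℝ) (hF : ∀ i, k < i → F i = 0)
    (hG : ∀ i, i < k → G i = 0) :
    ∑ j : Fin (n+2), (if j ≤ k.castSucc then F (k.predAbove j) else G (k.predAbove j))
      = ∑ i, F i + ∑ i, G i := by
  have : ∀ j : Fin (n+2), (if j ≤ k.castSucc then F (k.predAbove j) else G (k.predAbove j))
      = (if j ≤ k.castSucc then F (k.predAbove j) else 0)
        + (if j ≤ k.castSucc then 0 else G (k.predAbove j)) := by
    intro j; split_ifs <;> simp
  simp_rw [this]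
  rw [Finset.sum_add_distrib]
  congr 1
  · rw [Fin.sum_univ_castSucc, if_neg (by simp), add_zero]
    refine Finset.sum_congr rfl fun i _ => ?_
    by_cases h : i ≤ k
    · rw [if_pos (by simpa using h), Fin.predAbove_castSucc_of_le _ _ h]
    · rw [if_neg (by simpa using h), hF i (not_le.1 h)]
  · rw [Fin.sum_univ_succ, if_pos (by simp), zero_add]
    refine Finset.sum_congr rfl fun i _ => ?_
    by_cases h : k ≤ i
    · rw [if_neg (by rw [Fin.le_iff_val_le_val] at *; simp only [Fin.val_succ, Fin.val_castSucc]; omega), Fin.predAbove_succ_of_le _ _ h]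
    · push Not at h
      rw [if_pos (by rw [Fin.le_iff_val_le_val]; rw [Fin.lt_def] at h; simp only [Fin.val_succ, Fin.val_castSucc]; omega), hG i h]

def M (f g : P →o P) {n : ℕ} (a : Fin (n+1) →o P) (p : Fin (n+1) → ℝ) (u : ℝ) : P → ℝ :=
  meas (f ∘ a) (low p u) + meas (g ∘ a) (p - low p u)

lemma push_sub {m n : ℕ} (θ : Fin (m+1) → Fin (n+1)) (v w : Fin (m+1) → ℝ) :
    push θ (v - w) = push θ v - push θ w := by
  ext j
  simp only [push, Pi.sub_apply, ← Finset.sum_sub_distrib]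
  refine Finset.sum_congr rfl fun i _ => ?_
  split_ifs <;> simp

lemma M_comp (f g : P →o P) {m n : ℕ} (a : Fin (n+1) →o P) (θ : Fin (m+1) →o Fin (n+1))
    (p : Fin (m+1) → ℝ) (u : ℝ) (hu : 0 ≤ u) :
    M f g (a.comp θ) p u = M f g a (push θ p) u := by
  simp only [M, low_push θ p u hu, ← push_sub, ← meas_comp]
  rfl

def chain (f g : P →o P) (h : f ≤ g) {n : ℕ} (a : Fin (n+1) →o P) (k : Fin (n+1)) :
    Fin (n+2) →o P where
  toFun j := if j ≤ k.castSucc then f (a (k.predAbove j)) else g (a (k.predAbove j))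
  monotone' := by
    intro x y hxy
    have h1 : a (k.predAbove x) ≤ a (k.predAbove y) :=
      a.monotone (Fin.predAbove_right_monotone _ hxy)
    dsimp only
    split_ifs with h2 h3 h3
    · exact f.monotone h1
    · exact (f.monotone h1).trans (h _)
    · exact absurd (hxy.trans h3) h2
    · exact g.monotone h1

def wt {n : ℕ} (p : Fin (n+1) → ℝ) (u : ℝ) (k : Fin (n+1)) (j : Fin (n+2)) : ℝ :=
  if j ≤ k.castSucc then low p u (k.predAbove j) else (p - low p u) (k.predAbove j)

def piece {n : ℕ} (k : Fin (n+1)) : Set (stdSimplex ℝ (Fin (n+1)) × unitInterval) :=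
  {x | ∑ j ∈ Finset.Iio k, x.1 j ≤ x.2 ∧ (x.2 : ℝ) ≤ ∑ j ∈ Finset.Iic k, x.1 j}

lemma low_zero {n : ℕ} (p : stdSimplex ℝ (Fin (n+1))) (u : ℝ) (k : Fin (n+1))
    (h : u ≤ ∑ j ∈ Finset.Iic k, p j) (i) (hi : k < i) : low p u i = 0 := by
  have h1 : ∑ j ∈ Finset.Iic k, p j ≤ ∑ j ∈ Finset.Iio i, p j :=
    Finset.sum_le_sum_of_subset_of_nonneg (fun x hx => by
      simp only [Finset.mem_Iic, Finset.mem_Iio] at *; exact hx.trans_lt hi) (fun _ _ _ => p.2.1 _)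
  have h2 : 0 ≤ p i := p.2.1 i
  rw [low, sum_Iic_eq, min_eq_right (by linarith), min_eq_right (by linarith), sub_self]

lemma low_self {n : ℕ} (p : stdSimplex ℝ (Fin (n+1))) (u : ℝ) (i : Fin (n+1))
    (h : ∑ j ∈ Finset.Iic i, p j ≤ u) : low p u i = p i := by
  have h2 : 0 ≤ p i := p.2.1 i
  rw [low, min_eq_left h]
  rw [sum_Iic_eq] at *
  rw [min_eq_left (by linarith)]
  ring

lemma low_self' {n : ℕ} (p : stdSimplex ℝ (Fin (n+1))) (u : ℝ) (k : Fin (n+1))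
    (h : ∑ j ∈ Finset.Iio k, p j ≤ u) (i) (hi : i < k) : low p u i = p i := by
  apply low_self
  refine le_trans ?_ h
  exact Finset.sum_le_sum_of_subset_of_nonneg (fun x hx => by
      simp only [Finset.mem_Iic, Finset.mem_Iio] at *; exact hx.trans_lt hi) (fun _ _ _ => p.2.1 _)

lemma low_nonneg {n : ℕ} (p : stdSimplex ℝ (Fin (n+1))) (u : ℝ) (i) : 0 ≤ low p u i := by
  have h2 : 0 ≤ p i := p.2.1 i
  rw [low, sum_Iic_eq]
  exact sub_nonneg.2 (min_le_min (by linarith) le_rfl)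

lemma low_le {n : ℕ} (p : stdSimplex ℝ (Fin (n+1))) (u : ℝ) (i) : low p u i ≤ p i := by
  have h2 : 0 ≤ p i := p.2.1 i
  rw [low, sum_Iic_eq]
  rcases le_total (∑ j ∈ Finset.Iio i, p j) u with h | h
  · rw [min_eq_left h]
    linarith [min_le_left (∑ j ∈ Finset.Iio i, p j + p i) u]
  · rw [min_eq_right h]
    linarith [min_le_right (∑ j ∈ Finset.Iio i, p j + p i) u]

lemma wt_mem {n : ℕ} (k : Fin (n+1)) (x) (hx : x ∈ piece k) :
    wt x.1 x.2 k ∈ stdSimplex ℝ (Fin (n+2)) := by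
  constructor
  · intro j
    rw [wt]
    split_ifs
    · exact low_nonneg _ _ _
    · exact sub_nonneg.2 (low_le _ _ _)
  · simp only [wt]
    rw [sum_prism]
    · rw [← Finset.sum_add_distrib, ← stdSimplex.sum_eq_one x.1]
      simp
    · exact low_zero _ _ _ hx.2
    · intro i hi
      exact sub_eq_zero.2 (low_self' _ _ _ hx.1 i hi).symm

lemma meas_chain (f g : P →o P) (h : f ≤ g) {n : ℕ} (a : Fin (n+1) →o P) (k : Fin (n+1))
    (x) (hx : x ∈ piece k) : meas (chain f g h a k) (wt x.1 x.2 k) = M f g a x.1 x.2 := by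
  classical
  ext y
  simp only [M, Pi.add_apply, meas]
  rw [← sum_prism k]
  · refine Finset.sum_congr rfl fun j _ => ?_
    by_cases hj : j ≤ k.castSucc
    · have e : chain f g h a k j = f (a (k.predAbove j)) := if_pos hj
      rw [e, wt, if_pos hj, if_pos hj]
      rfl
    · have e : chain f g h a k j = g (a (k.predAbove j)) := if_neg hj
      rw [e, wt, if_neg hj, if_neg hj]
      rfl
  · intro i hi
    rw [low_zero _ _ _ hx.2 i hi, ite_self]
  · intro i hi
    rw [Pi.sub_apply, low_self' _ _ _ hx.1 i hi, sub_self, ite_self]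

lemma cover {n : ℕ} : ⋃ k : Fin (n+1), piece k = Set.univ := by
  rw [Set.eq_univ_iff_forall]
  rintro ⟨p, u⟩
  let T : Set (Fin (n+1)) := {k | (u : ℝ) ≤ ∑ j ∈ Finset.Iic k, p j}
  have hT : T.Nonempty := ⟨Fin.last n, by
    have : Finset.Iic (Fin.last n) = Finset.univ := by ext x; simp [Fin.le_last]
    simp only [T, Set.mem_setOf_eq, this, stdSimplex.sum_eq_one]
    exact u.2.2⟩
  obtain ⟨k, hk, hmin⟩ := WellFounded.has_min (wellFounded_lt (α := Fin (n+1))) T hT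
  refine Set.mem_iUnion.2 ⟨k, ?_, hk⟩
  dsimp only
  induction k using Fin.cases with
  | zero =>
    have : Finset.Iio (0 : Fin (n+1)) = ∅ := by ext x; simp
    rw [this]; simpa using u.2.1
  | succ i =>
    have h1 := hmin i.castSucc
    have : Finset.Iio i.succ = Finset.Iic i.castSucc := by
      ext x; simp [Fin.lt_def, Fin.le_def, Nat.lt_succ_iff]
    rw [this]
    by_contra h2
    exact h1 (not_le.1 h2).le (Fin.castSucc_lt_succ)

lemma continuous_coord {n : ℕ} (i : Fin (n+1)) :
    Continuous (fun x : stdSimplex ℝ (Fin (n+1)) × unitInterval => x.1 i) :=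
  (continuous_apply i).comp (continuous_subtype_val.comp continuous_fst)

lemma continuous_wt {n : ℕ} (k : Fin (n+1)) :
    Continuous (fun x : stdSimplex ℝ (Fin (n+1)) × unitInterval => wt x.1 x.2 k) := by
  have hu : Continuous (fun x : stdSimplex ℝ (Fin (n+1)) × unitInterval => (x.2 : ℝ)) :=
    continuous_subtype_val.comp continuous_snd
  have hl : ∀ i, Continuous
      (fun x : stdSimplex ℝ (Fin (n+1)) × unitInterval => low x.1 x.2 i) := by
    intro i
    exact ((continuous_finset_sum _ fun j _ => continuous_coord j).min hu).sub
      ((continuous_finset_sum _ fun j _ => continuous_coord j).min hu)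
  refine continuous_pi fun j => ?_
  simp only [wt]
  split_ifs
  · exact hl _
  · exact (continuous_coord _).sub (hl _)

lemma isClosed_piece {n : ℕ} (k : Fin (n+1)) : IsClosed (piece k) := by
  have hu : Continuous (fun x : stdSimplex ℝ (Fin (n+1)) × unitInterval => (x.2 : ℝ)) :=
    continuous_subtype_val.comp continuous_snd
  exact (isClosed_le (continuous_finset_sum _ fun j _ => continuous_coord j) hu).inter
    (isClosed_le hu (continuous_finset_sum _ fun j _ => continuous_coord j))

def H [Nonempty P] (f g : P →o P) (h : f ≤ g) {n : ℕ} (a : Fin (n+1) →o P) :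
    C(stdSimplex ℝ (Fin (n+1)) × unitInterval, SSet.toTop.obj (nerve P)) where
  toFun x := PT P (M f g a x.1 x.2)
  continuous_toFun := by
    refine (locallyFinite_of_finite _).continuous cover isClosed_piece fun k => ?_
    rw [continuousOn_iff_continuous_restrict]
    have : (piece k).domRestrict (fun x => PT P (M f g a x.1 x.2)) =
        fun x : piece k => pt (chain f g h a k) ⟨wt x.1.1 x.1.2 k, wt_mem k x.1 x.2⟩ := by
      ext x
      exact PT_eq _ _ _ (meas_chain f g h a k x.1 x.2)
    rw [this]
    exact (pt _).continuous.comp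
      (((continuous_wt k).comp continuous_subtype_val).subtype_mk _)

lemma H_comp [Nonempty P] (f g : P →o P) (h : f ≤ g) {m n : ℕ} (a : Fin (n+1) →o P)
    (θ : Fin (m+1) →o Fin (n+1)) (p : stdSimplex ℝ (Fin (m+1))) (u : unitInterval) :
    H f g h (a.comp θ) (p, u) = H f g h a (stdSimplex.map θ p, u) := by
  change PT P _ = PT P _
  dsimp only
  rw [M_comp _ _ _ _ _ _ u.2.1, map_eq_push]

lemma H_one [Nonempty P] (f g : P →o P) (h : f ≤ g) {n : ℕ} (a : Fin (n+1) →o P)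
    (p : stdSimplex ℝ (Fin (n+1))) : H f g h a (p, 1) = pt (f.comp a) p := by
  refine PT_eq _ _ _ ?_
  have : low p 1 = p := by
    ext i
    apply low_self
    rw [← stdSimplex.sum_eq_one p]
    exact Finset.sum_le_sum_of_subset_of_nonneg (Finset.subset_univ _) (fun _ _ _ => p.2.1 _)
  ext y
  simp [M, this, meas]
  rfl

lemma H_zero [Nonempty P] (f g : P →o P) (h : f ≤ g) {n : ℕ} (a : Fin (n+1) →o P)
    (p : stdSimplex ℝ (Fin (n+1))) : H f g h a (p, 0) = pt (g.comp a) p := by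
  refine PT_eq _ _ _ ?_
  have : low p 0 = 0 := by
    ext i
    rw [low, min_eq_right, min_eq_right]
    · simp
    all_goals exact Finset.sum_nonneg fun _ _ => p.2.1 _
  ext y
  simp [M, this, meas]
  rfl

def ord {n : SimplexCategoryᵒᵖ} (σ : (nerve P).obj n) : Fin (n.unop.len + 1) →o P :=
  ⟨Functor.obj (C := Fin (n.unop.len + 1)) (D := P) σ,
    Functor.monotone (X := Fin (n.unop.len + 1)) (Y := P) σ⟩

/-- The simplicial map adjoint to a map out of the realization. -/
def descAux {X : Type} [TopologicalSpace X]
    (F : ∀ n : ℕ, (Fin (n+1) →o P) → C(stdSimplex ℝ (Fin (n+1)), X))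
    (hF : ∀ (m n : ℕ) (a : Fin (n+1) →o P) (θ : Fin (m+1) →o Fin (n+1)) p,
      F m (a.comp θ) p = F n a (stdSimplex.map θ p)) :
    nerve P ⟶ TopCat.toSSet.obj (TopCat.of X) where
  app n := ↾fun σ => (TopCat.toSSetObjEquiv (TopCat.of X) n).symm (F _ (ord σ))
  naturality := by
    intro n m θ
    ext σ
    apply (TopCat.toSSetObjEquiv (TopCat.of X) m).injective
    ext p
    exact hF _ _ (ord σ) θ.unop.toOrderHom p

/-- Maps out of the realization. -/
def desc {X : Type} [TopologicalSpace X]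
    (F : ∀ n : ℕ, (Fin (n+1) →o P) → C(stdSimplex ℝ (Fin (n+1)), X))
    (hF : ∀ (m n : ℕ) (a : Fin (n+1) →o P) (θ : Fin (m+1) →o Fin (n+1)) p,
      F m (a.comp θ) p = F n a (stdSimplex.map θ p)) : C(SSet.toTop.obj (nerve P), X) :=
  ((sSetTopAdj.homEquiv (nerve P) (TopCat.of X)).symm (descAux F hF)).hom

lemma desc_pt {X : Type} [TopologicalSpace X]
    (F : ∀ n : ℕ, (Fin (n+1) →o P) → C(stdSimplex ℝ (Fin (n+1)), X)) (hF)
    {n : ℕ} (a : Fin (n+1) →o P) (p) : desc F hF (pt a p) = F n a p := by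
  have := (sSetTopAdj.homEquiv (nerve P) (TopCat.of X)).apply_symm_apply (descAux F hF)
  rw [Adjunction.homEquiv_unit] at this
  have := congrArg (fun S : nerve P ⟶ TopCat.toSSet.obj (TopCat.of X) =>
    TopCat.toSSetObjEquiv _ _ (S.app (op ⦋n⦌) (mk a)) p) this
  exact this

lemma hom_ext' {X : Type} [TopologicalSpace X] (α β : C(SSet.toTop.obj (nerve P), X))
    (h : ∀ {n : ℕ} (a : Fin (n+1) →o P) p, α (pt a p) = β (pt a p)) : α = β := by
  have : TopCat.ofHom α = TopCat.ofHom β := by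
    apply (sSetTopAdj.homEquiv (nerve P) (TopCat.of X)).injective
    rw [Adjunction.homEquiv_unit, Adjunction.homEquiv_unit]
    ext n σ
    apply (TopCat.toSSetObjEquiv (TopCat.of X) n).injective
    ext p
    exact h (ord σ) p
  exact congrArg TopCat.Hom.hom this

/-- realization of a monotone map -/
def real (f : P →o P) : C(SSet.toTop.obj (nerve P), SSet.toTop.obj (nerve P)) :=
  desc (fun _ a => pt (f.comp a)) (fun _ _ a θ p => pt_comp (f.comp a) θ p)

lemma real_pt (f : P →o P) {n : ℕ} (a : Fin (n+1) →o P) (p) :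
    real f (pt a p) = pt (f.comp a) p :=
  desc_pt (fun _ a => pt (f.comp a)) (fun _ _ a θ p => pt_comp (f.comp a) θ p) a p

lemma real_homotopic [Nonempty P] (f g : P →o P) (h : f ≤ g) : (real f).Homotopic (real g) := by
  let K : C(SSet.toTop.obj (nerve P), C(unitInterval, SSet.toTop.obj (nerve P))) :=
    desc (fun _ a => (H f g h a).curry) (fun _ _ a θ p => by
      ext u
      exact H_comp f g h a θ p u)
  have hK : ∀ {n : ℕ} (a : Fin (n+1) →o P) p u, K (pt a p) u = H f g h a (p, u) := by
    intro n a p u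
    simp only [K, desc_pt]
    rfl
  have h0 : ∀ x, K x 0 = real g x := by
    have : (⟨fun φ => φ 0, by fun_prop⟩ : C(C(unitInterval, SSet.toTop.obj (nerve P)), _)).comp K
        = real g := by
      apply hom_ext'
      intro n a p
      simp only [ContinuousMap.comp_apply, ContinuousMap.coe_mk, hK, H_zero, real_pt]
    exact fun x => DFunLike.congr_fun this x
  have h1 : ∀ x, K x 1 = real f x := by
    have : (⟨fun φ => φ 1, by fun_prop⟩ : C(C(unitInterval, SSet.toTop.obj (nerve P)), _)).comp K
        = real f := by
      apply hom_ext'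
      intro n a p
      simp only [ContinuousMap.comp_apply, ContinuousMap.coe_mk, hK, H_one, real_pt]
    exact fun x => DFunLike.congr_fun this x
  symm
  exact ⟨{ toFun := fun x => K x.2 x.1
           continuous_toFun := by fun_prop
           map_zero_left := h0
           map_one_left := h1 }⟩

lemma contractible (f : P →o P) (b : P) (h1 : ∀ x, x ≤ f x) (h2 : ∀ x, b ≤ f x) :
    ContractibleSpace (SSet.toTop.obj (nerve P)) := by
  haveI : Nonempty P := ⟨b⟩
  rw [contractible_iff_id_nullhomotopic]
  refine ⟨pt (OrderHom.const (Fin 1) b) default, ?_⟩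
  have e1 : real (OrderHom.id : P →o P) = ContinuousMap.id _ := by
    apply hom_ext'
    intro n a p
    simp [real_pt]
  have e2 : real (OrderHom.const P b) =
      ContinuousMap.const _ (pt (OrderHom.const (Fin 1) b) default) := by
    apply hom_ext'
    intro n a p
    simp only [real_pt, ContinuousMap.const_apply]
    rw [show (OrderHom.const P b).comp a = (OrderHom.const (Fin 1) b).comp
      (OrderHom.const (Fin (n+1)) (0 : Fin 1)) from rfl]
    refine (pt_comp (m := n) (n := 0) _ _ _).trans ?_
    congr 1
    exact Subsingleton.elim (α := stdSimplex ℝ (Fin 1)) _ _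
  rw [← e1, ← e2]
  exact (real_homotopic OrderHom.id f h1).trans (real_homotopic (OrderHom.const P b) f h2).symm

end DFC
end

end

/-- For the map `f` from simplices of `𝓛(V)` (nonempty finite sets of
lines spanning a proper subspace of `V`) to the poset of nonzero proper subspaces of `V`,
sending a simplex to the span of its vertices, every downward fiber
`f_{≤ W} = {σ | span σ ≤ W}` over a nonzero proper subspace `W` is contractible
(being the face poset of a cone, namely of the full simplex `𝒦(W)`). -/
theorem downward_fiber_contractible
    (K : Type) [Field K] (V : Type) [AddCommGroup V] [Module K V]
    [FiniteDimensional K V]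
    (W : Submodule K V) (hW0 : W ≠ ⊥) (hWtop : W ≠ ⊤) :
    ContractibleSpace
      (SSet.toTop.obj (CategoryTheory.nerve
        {s : Finset (Submodule K V) //
          s.Nonempty ∧ (∀ L ∈ s, finrank K ↥L = 1) ∧ s.sup id ≠ ⊤ ∧ s.sup id ≤ W})) := by
  classical
  obtain ⟨v, hv, hv0⟩ := Submodule.exists_mem_ne_zero_of_ne_bot hW0
  have hL : finrank K ↥(Submodule.span K {v}) = 1 := finrank_span_singleton hv0
  have hLW : Submodule.span K {v} ≤ W := by
    rw [Submodule.span_le]; simpa using hv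
  have hne : ∀ U : Submodule K V, U ≤ W → U ≠ ⊤ := fun U hU h => hWtop (top_le_iff.1 (h ▸ hU))
  refine DFC.contractible
    ⟨fun s => ⟨insert (Submodule.span K {v}) s.1, Finset.insert_nonempty _ _, ?_, ?_, ?_⟩, ?_⟩
    ⟨{Submodule.span K {v}}, Finset.singleton_nonempty _, ?_, ?_, ?_⟩ ?_ ?_
  · intro L hLs
    rcases Finset.mem_insert.1 hLs with rfl | h
    · exact hL
    · exact s.2.2.1 L h
  · apply hne
    rw [Finset.sup_insert]
    exact sup_le hLW s.2.2.2.2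
  · rw [Finset.sup_insert]
    exact sup_le hLW s.2.2.2.2
  · intro s t hst
    exact Finset.insert_subset_insert _ hst
  · intro L h
    rw [Finset.mem_singleton.1 h]
    exact hL
  · apply hne
    simpa using hv
  · simpa using hv
  · intro s
    exact Finset.subset_insert _ _
  · intro s
    exact Finset.singleton_subset_iff.2 (Finset.mem_insert_self _ _)
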